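/- arXiv:math/0404040 — 3 statements merged into one kernel-verified Lean document; each statement's English description precedes it below -/
import Mathlib

section
/- Let G be a group and {H_λ}_{λ∈Λ} a collection of subgroups of G. Suppose that G is generated by a finite set X in the ordinary (non-relative) sense and that G is finitely presented relative to {H_λ}_{λ∈Λ}. Then each subgroup H_λ is finitely generated. -/
namespace RelHyp

variable {G : Type*} [Group G] {Λ : Type*}

/-- Length of a shortest word over the alphabet `S ∪ S⁻¹` representing `g`. -/
noncomputable def wordLength (S : Set G) (g : G) : ℕ :=
  sInf {n | ∃ w : List G, w.length = n ∧ (∀ x ∈ w, x ∈ S ∨ x⁻¹ ∈ S) ∧ w.prod = g}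

/-- The free product `F = (∗_λ H_λ) ∗ F(X)`. -/
abbrev RelFree (H : Λ → Subgroup G) (X : Set G) : Type _ :=
  Monoid.Coprod (Monoid.CoprodI fun l => ↥(H l)) (FreeGroup ↥X)

/-- The canonical homomorphism `ε : F → G`. -/
def relEps (H : Λ → Subgroup G) (X : Set G) : RelFree H X →* G :=
  Monoid.Coprod.lift (Monoid.CoprodI.lift fun l => (H l).subtype)
    (FreeGroup.lift fun x => (x : G))

/-- Letters of the alphabet `X ∪ 𝓗`, where `𝓗 = ⊔_λ (H̃_λ ∖ {1})`. -/
abbrev RelLetter (H : Λ → Subgroup G) (X : Set G) : Type _ :=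
  (Σ l : Λ, {h : ↥(H l) // h ≠ 1}) ⊕ (↥X × Bool)

/-- The image of a letter in the free product `F`. -/
def RelLetter.toF {H : Λ → Subgroup G} {X : Set G} : RelLetter H X → RelFree H X
  | Sum.inl ⟨_, h⟩ => Monoid.Coprod.inl (Monoid.CoprodI.of h.1)
  | Sum.inr (x, b) => Monoid.Coprod.inr (if b then FreeGroup.of x else (FreeGroup.of x)⁻¹)

/-- The element of `G` represented by a letter. -/
def RelLetter.val {H : Λ → Subgroup G} {X : Set G} : RelLetter H X → G
  | Sum.inl ⟨_, h⟩ => (h.1 : G)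
  | Sum.inr (x, b) => if b then (x : G) else (x : G)⁻¹

/-- The index `λ` such that the letter belongs to `H̃_λ`, if any. -/
def RelLetter.hIndex {H : Λ → Subgroup G} {X : Set G} : RelLetter H X → Option Λ
  | Sum.inl ⟨l, _⟩ => some l
  | Sum.inr _ => none

/-- The element of `F` represented by a word over `X ∪ 𝓗`. -/
def wordToF {H : Λ → Subgroup G} {X : Set G} (w : List (RelLetter H X)) : RelFree H X :=
  (w.map RelLetter.toF).prod

/-- `f` is a relative isoperimetric function of the relative presentation `⟨X, H | R⟩`. -/
def IsIsoperFn (H : Λ → Subgroup G) (X : Set G) (R : Set (RelFree H X)) (f : ℕ → ℕ) : Prop :=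
  ∀ w : List (RelLetter H X), relEps H X (wordToF w) = 1 →
    ∃ k ≤ f w.length, ∃ r c : Fin k → RelFree H X,
      (∀ i, r i ∈ R) ∧ wordToF w = (List.ofFn fun i => (c i)⁻¹ * r i * c i).prod

/-- `⟨X, H | R⟩` is a finite relative presentation of `G` w.r.t. the collection `H`. -/
structure IsFiniteRelPres (H : Λ → Subgroup G) (X : Set G) (R : Set (RelFree H X)) : Prop where
  finX : X.Finite
  finR : R.Finite
  surj : Function.Surjective (relEps H X)
  ker : (relEps H X).ker = Subgroup.normalClosure R

/-- `G` is finitely presented relative to the collection of subgroups `H`. -/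
def FinitelyPresentedRel (H : Λ → Subgroup G) : Prop :=
  ∃ (X : Set G) (R : Set (RelFree H X)), IsFiniteRelPres H X R

/-- The relative area of a word representing `1`. -/
noncomputable def relArea (H : Λ → Subgroup G) (X : Set G) (R : Set (RelFree H X))
    (w : List (RelLetter H X)) : ℕ :=
  sInf {k | ∃ r c : Fin k → RelFree H X,
    (∀ i, r i ∈ R) ∧ wordToF w = (List.ofFn fun i => (c i)⁻¹ * r i * c i).prod}

/-- The relative Dehn function of the presentation `⟨X, H | R⟩`. -/
noncomputable def relDehn (H : Λ → Subgroup G) (X : Set G) (R : Set (RelFree H X))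
    (n : ℕ) : ℕ :=
  sSup {a | ∃ w : List (RelLetter H X), w.length ≤ n ∧ relEps H X (wordToF w) = 1 ∧
    a = relArea H X R w}

/-- The relative Dehn function is well-defined (finite for each value of the argument),
i.e. there exists a finite-valued relative isoperimetric function. -/
def DehnWellDefined (H : Λ → Subgroup G) (X : Set G) (R : Set (RelFree H X)) : Prop :=
  ∃ f : ℕ → ℕ, IsIsoperFn H X R f

/-- `f ⪯ g`. -/
def AsympLE (f g : ℕ → ℕ) : Prop := ∃ C K L : ℕ, ∀ n, f n ≤ C * g (K * n) + L * n

/-- `f ∼ g`. -/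
def AsympEquiv (f g : ℕ → ℕ) : Prop := AsympLE f g ∧ AsympLE g f

/-- `G` is hyperbolic relative to `H`: it admits a finite relative presentation with a
linear relative isoperimetric function. -/
def IsRelHyperbolic (H : Λ → Subgroup G) : Prop :=
  ∃ (X : Set G) (R : Set (RelFree H X)), IsFiniteRelPres H X R ∧
    ∃ A B : ℕ, IsIsoperFn H X R fun n => A * n + B

/-- The subnegative closure of `f`. -/
noncomputable def subnegClosure (f : ℕ → ℕ) (n : ℕ) : ℕ :=
  sSup {s | ∃ L : List ℕ, (∀ a ∈ L, 0 < a) ∧ L.sum = n ∧ s = (L.map f).sum}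

/-- A combinatorial path in the Cayley graph `Γ(G, X ∪ 𝓗)`: a starting vertex
together with the word labelling the path. -/
structure RelPath (H : Λ → Subgroup G) (X : Set G) where
  start : G
  word : List (RelLetter H X)

namespace RelPath

variable {H : Λ → Subgroup G} {X : Set G}

/-- The length of the path. -/
def len (p : RelPath H X) : ℕ := p.word.length

/-- The `k`-th vertex of the path. -/
def vertex (p : RelPath H X) (k : ℕ) : G :=
  p.start * ((p.word.take k).map RelLetter.val).prod

/-- The terminal vertex of the path. -/
def finish (p : RelPath H X) : G := p.vertex p.word.length

end RelPath

/-- The combinatorial metric `dist_{X ∪ 𝓗}` on `G`. -/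
noncomputable def relDist (H : Λ → Subgroup G) (X : Set G) (g h : G) : ℕ :=
  wordLength (X ∪ ⋃ l, (H l : Set G)) (g⁻¹ * h)

/-- The relative length `|g|_{X ∪ 𝓗}`. -/
noncomputable def relLen (H : Λ → Subgroup G) (X : Set G) (g : G) : ℕ :=
  wordLength (X ∪ ⋃ l, (H l : Set G)) g

/-- The word metric `dist_X` on `G`. -/
noncomputable def xDist (X : Set G) (g h : G) : ℕ := wordLength X (g⁻¹ * h)

variable {H : Λ → Subgroup G} {X : Set G}

/-- `p` is a `(λ, c)`-quasi-geodesic in `Γ(G, X ∪ 𝓗)`. -/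
def IsQuasiGeodesic (lam c : ℝ) (p : RelPath H X) : Prop :=
  ∀ i j : ℕ, i ≤ j → j ≤ p.len →
    ((j - i : ℕ) : ℝ) ≤ lam * (relDist H X (p.vertex i) (p.vertex j) : ℝ) + c

/-- `p` is a geodesic in `Γ(G, X ∪ 𝓗)`. -/
def IsGeodesic (p : RelPath H X) : Prop :=
  ∀ i j : ℕ, i ≤ j → j ≤ p.len → j - i = relDist H X (p.vertex i) (p.vertex j)

/-- The `k`-th letter of `p` is a letter of `H̃_l`. -/
def LetterIsH (p : RelPath H X) (l : Λ) (k : ℕ) : Prop :=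
  ∃ a, p.word[k]? = some a ∧ a.hIndex = some l

/-- The subpath of `p` consisting of the letters with indices `a, …, b` is an
`H_l`-component of `p` (a maximal nonempty `H_l`-subword). -/
def IsComponent (p : RelPath H X) (l : Λ) (a b : ℕ) : Prop :=
  a ≤ b ∧ b < p.len ∧ (∀ k, a ≤ k → k ≤ b → LetterIsH p l k) ∧
    (a = 0 ∨ ¬ LetterIsH p l (a - 1)) ∧ (b + 1 = p.len ∨ ¬ LetterIsH p l (b + 1))

/-- The `H_l`-components of `p` starting at index `a` and of `q` starting at `a'`
are connected (their vertices lie in the same left coset of `H_l`). -/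
def ConnectedComp (p q : RelPath H X) (l : Λ) (a a' : ℕ) : Prop :=
  (p.vertex a)⁻¹ * q.vertex a' ∈ H l

/-- `p` is a path without backtracking: all of its components are isolated. -/
def NoBacktracking (p : RelPath H X) : Prop :=
  ∀ l a b a' b', IsComponent p l a b → IsComponent p l a' b' →
    ConnectedComp p p l a a' → a = a' ∧ b = b'

/-- The `k`-th vertex of `p` is a phase vertex (not an inner vertex of a component). -/
def IsPhase (p : RelPath H X) (k : ℕ) : Prop :=
  ¬ ∃ l a b, IsComponent p l a b ∧ a < k ∧ k ≤ b

/-- `p` and `q` are `k`-similar: their endpoints are `X`-distance at most `k` apart. -/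
def Similar (k : ℝ) (p q : RelPath H X) : Prop :=
  (xDist X p.start q.start : ℝ) ≤ k ∧ (xDist X p.finish q.finish : ℝ) ≤ k

/-- The Rips thin-triangles condition for `Γ(G, X ∪ 𝓗)` with constant `δ`. -/
def RipsThin (H : Λ → Subgroup G) (X : Set G) (δ : ℝ) : Prop :=
  ∀ p q r : RelPath H X, IsGeodesic p → IsGeodesic q → IsGeodesic r →
    p.finish = q.start → q.finish = r.start → r.finish = p.start →
    ∀ i ≤ p.len, ∃ j : ℕ,
      (j ≤ q.len ∧ (relDist H X (p.vertex i) (q.vertex j) : ℝ) ≤ δ) ∨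
      (j ≤ r.len ∧ (relDist H X (p.vertex i) (r.vertex j) : ℝ) ≤ δ)

/-- The Cayley graph `Γ(G, X ∪ 𝓗)` is a hyperbolic metric space. -/
def CayleyHyperbolic (H : Λ → Subgroup G) (X : Set G) : Prop :=
  ∃ δ : ℝ, 0 ≤ δ ∧ RipsThin H X δ

/-- `R` is a relatively quasi-convex subgroup of `G`. -/
def RelQuasiconvex (H : Λ → Subgroup G) (X : Set G) (R : Subgroup G) : Prop :=
  ∃ σ : ℝ, 0 < σ ∧ ∀ p : RelPath H X, IsGeodesic p → p.start ∈ R → p.finish ∈ R →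
    ∀ k ≤ p.len, ∃ w ∈ R, (xDist X (p.vertex k) w : ℝ) ≤ σ

/-- `R` is a strongly relatively quasi-convex subgroup of `G`. -/
def StronglyRelQuasiconvex (H : Λ → Subgroup G) (X : Set G) (R : Subgroup G) : Prop :=
  RelQuasiconvex H X R ∧ ∀ (g : G) (l : Λ), {x : G | x ∈ R ∧ g * x * g⁻¹ ∈ H l}.Finite

/-- `g` is a hyperbolic element: it is not conjugate to an element of any `H_λ`. -/
def IsHypElt (H : Λ → Subgroup G) (g : G) : Prop :=
  ∀ l : Λ, ∀ x ∈ H l, ¬ IsConj g x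

end RelHyp

open RelHyp

namespace RelHyp

universe u v w

/-- The family of types indexed by `Bool` with values `A` and `B`. -/
def BoolFamily (A B : Type u) : Bool → Type u
  | true => A
  | false => B

instance (A B : Type u) [Group A] [Group B] : ∀ i, Group (BoolFamily A B i)
  | true => inferInstanceAs (Group A)
  | false => inferInstanceAs (Group B)

/-- Amalgamated free products exist and satisfy the intersection property. -/
theorem exists_amalgam_of_same_universe {A B : Type u} {K : Type v} [Group A] [Group B]
    [Group K] (a : K →* A) (b : K →* B) (ha : Function.Injective a) (hb : Function.Injective b) :
    ∃ (P : Type (max u v)) (_ : Group P) (f : A →* P) (g : B →* P),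
      (∀ k, f (a k) = g (b k)) ∧ ∀ x y, f x = g y → ∃ k, b k = y := by
  let φ : ∀ i, K →* BoolFamily A B i
    | true => a
    | false => b
  have hφ : ∀ i, Function.Injective (φ i)
    | true => ha
    | false => hb
  let f : A →* Monoid.PushoutI φ := Monoid.PushoutI.of (φ := φ) true
  let g : B →* Monoid.PushoutI φ := Monoid.PushoutI.of (φ := φ) false
  have hf : ∀ k, f (a k) = Monoid.PushoutI.base φ k :=
    fun k => Monoid.PushoutI.of_apply_eq_base φ true k
  have hg : ∀ k, g (b k) = Monoid.PushoutI.base φ k :=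
    fun k => Monoid.PushoutI.of_apply_eq_base φ false k
  have hginj : Function.Injective g := Monoid.PushoutI.of_injective hφ false
  refine ⟨Monoid.PushoutI φ, inferInstance, f, g, fun k => (hf k).trans (hg k).symm, ?_⟩
  intro x y hxy
  have hmem : g y ∈ (Monoid.PushoutI.of (φ := φ) true).range ⊓
      (Monoid.PushoutI.of (φ := φ) false).range := ⟨⟨x, hxy⟩, ⟨y, rfl⟩⟩
  rw [Monoid.PushoutI.inf_of_range_eq_base_range hφ (by decide)] at hmem
  obtain ⟨k, hk⟩ := hmem
  exact ⟨k, hginj ((hg k).trans hk)⟩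

theorem exists_amalgam {A : Type u} {B : Type v} {K : Type w} [Group A] [Group B] [Group K]
    (a : K →* A) (b : K →* B) (ha : Function.Injective a) (hb : Function.Injective b) :
    ∃ (P : Type (max u v w)) (_ : Group P) (f : A →* P) (g : B →* P),
      (∀ k, f (a k) = g (b k)) ∧ ∀ x y, f x = g y → ∃ k, b k = y := by
  obtain ⟨P, instP, f, g, hfg, hint⟩ := exists_amalgam_of_same_universe
    ((MulEquiv.ulift : ULift.{v} A ≃* A).symm.toMonoidHom.comp a)
    ((MulEquiv.ulift : ULift.{u} B ≃* B).symm.toMonoidHom.comp b)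
    (MulEquiv.ulift.symm.injective.comp ha) (MulEquiv.ulift.symm.injective.comp hb)
  refine ⟨P, instP, f.comp (MulEquiv.ulift : ULift.{v} A ≃* A).symm.toMonoidHom,
    g.comp (MulEquiv.ulift : ULift.{u} B ≃* B).symm.toMonoidHom, hfg, fun x y hxy => ?_⟩
  obtain ⟨k, hk⟩ := hint _ _ hxy
  exact ⟨k, MulEquiv.ulift.symm.injective hk⟩

variable {G : Type*} [Group G] {Λ : Type*} {H : Λ → Subgroup G} {X : Set G}

/-- The subgroup of `F` generated by `X`, by all `H̃_μ` with `μ ≠ l`, and by `K ≤ H̃_l`. -/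
def restrictedFree (X : Set G) (l : Λ) (K : Subgroup (H l)) : Subgroup (RelFree H X) :=
  (⨆ (μ : Λ) (_ : μ ≠ l), (Monoid.Coprod.inl.comp
      (Monoid.CoprodI.of (M := fun l => ↥(H l)) (i := μ))).range) ⊔
    (K.map (Monoid.Coprod.inl.comp (Monoid.CoprodI.of (M := fun l => ↥(H l)) (i := l))) ⊔
      (Monoid.Coprod.inr : FreeGroup ↥X →* RelFree H X).range)

theorem restrictedFree_mono (l : Λ) {K K' : Subgroup (H l)} (h : K ≤ K') :
    restrictedFree X l K ≤ restrictedFree X l K' :=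
  sup_le_sup_left (sup_le_sup_right (Subgroup.map_mono h) _) _

theorem inl_of_mem_restrictedFree {l μ : Λ} (hμ : μ ≠ l) (K : Subgroup (H l)) (h : H μ) :
    (Monoid.Coprod.inl (Monoid.CoprodI.of h) : RelFree H X) ∈ restrictedFree X l K :=
  Subgroup.mem_sup_left <| Subgroup.mem_iSup_of_mem μ <| Subgroup.mem_iSup_of_mem hμ ⟨h, rfl⟩

theorem inl_of_mem_restrictedFree_self {l : Λ} {K : Subgroup (H l)} {h : H l} (hh : h ∈ K) :
    (Monoid.Coprod.inl (Monoid.CoprodI.of h) : RelFree H X) ∈ restrictedFree X l K :=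
  Subgroup.mem_sup_right <| Subgroup.mem_sup_left ⟨h, hh, rfl⟩

theorem inr_mem_restrictedFree {l : Λ} (K : Subgroup (H l)) (x : FreeGroup ↥X) :
    (Monoid.Coprod.inr x : RelFree H X) ∈ restrictedFree X l K :=
  Subgroup.mem_sup_right <| Subgroup.mem_sup_right ⟨x, rfl⟩

theorem exists_fg_mem_restrictedFree (l : Λ) (w : RelFree H X) :
    ∃ K : Subgroup (H l), K.FG ∧ w ∈ restrictedFree X l K := by
  have hmul : ∀ u v : RelFree H X, (∃ K : Subgroup (H l), K.FG ∧ u ∈ restrictedFree X l K) →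
      (∃ K : Subgroup (H l), K.FG ∧ v ∈ restrictedFree X l K) →
      ∃ K : Subgroup (H l), K.FG ∧ u * v ∈ restrictedFree X l K := by
    rintro u v ⟨K, hK, hu⟩ ⟨K', hK', hv⟩
    exact ⟨K ⊔ K', hK.sup hK', mul_mem (restrictedFree_mono l le_sup_left hu)
      (restrictedFree_mono l le_sup_right hv)⟩
  induction w using Monoid.Coprod.induction_on with
  | inl m =>
    induction m using Monoid.CoprodI.induction_on with
    | one => exact ⟨⊥, Subgroup.FG.bot, by simp⟩
    | of μ h =>
      by_cases hμ : μ = l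
      · subst hμ
        exact ⟨Subgroup.closure {h}, ⟨{h}, by simp⟩,
          inl_of_mem_restrictedFree_self (Subgroup.subset_closure rfl)⟩
      · exact ⟨⊥, Subgroup.FG.bot, inl_of_mem_restrictedFree hμ _ h⟩
    | mul x y hx hy => rw [map_mul]; exact hmul _ _ hx hy
  | inr x => exact ⟨⊥, Subgroup.FG.bot, inr_mem_restrictedFree _ x⟩
  | mul x y hx hy => exact hmul _ _ hx hy

theorem exists_fg_subset_restrictedFree (l : Λ) {S : Set (RelFree H X)} (hS : S.Finite) :
    ∃ K : Subgroup (H l), K.FG ∧ S ⊆ restrictedFree X l K := by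
  induction S, hS using Set.Finite.induction_on with
  | empty => exact ⟨⊥, Subgroup.FG.bot, Set.empty_subset _⟩
  | @insert w S _ _ ih =>
    obtain ⟨K, hK, hSK⟩ := ih
    obtain ⟨K', hK', hw⟩ := exists_fg_mem_restrictedFree l w
    refine ⟨K ⊔ K', hK.sup hK', Set.insert_subset (restrictedFree_mono l le_sup_right hw)
      (hSK.trans (restrictedFree_mono l le_sup_left))⟩

/-- Homomorphisms on `restrictedFree X l K` and on `H_l` which agree on `K` extend to `F`. -/
theorem exists_extension (l : Λ) (K : Subgroup (H l)) {P : Type*} [Group P]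
    (p : restrictedFree X l K →* P) (g : H l →* P)
    (hpg : ∀ k : K, p ⟨_, inl_of_mem_restrictedFree_self k.2⟩ = g k) :
    ∃ Φ : RelFree H X →* P, (∀ h : H l, Φ (Monoid.Coprod.inl (Monoid.CoprodI.of h)) = g h) ∧
      ∀ w : restrictedFree X l K, Φ w = p w := by
  classical
  let Φ : RelFree H X →* P := Monoid.Coprod.lift
    (Monoid.CoprodI.lift fun μ =>
      if hμ : μ = l then g.comp (MulEquiv.subgroupCongr (congrArg H hμ)).toMonoidHom
      else p.comp ((Monoid.Coprod.inl.comp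
        (Monoid.CoprodI.of (M := fun l => ↥(H l)) (i := μ))).codRestrict _
          (inl_of_mem_restrictedFree hμ K)))
    (p.comp (Monoid.Coprod.inr.codRestrict _ (inr_mem_restrictedFree K)))
  have hΦl : ∀ h : H l, Φ (Monoid.Coprod.inl (Monoid.CoprodI.of h)) = g h := by
    intro h
    simp only [Φ, Monoid.Coprod.lift_apply_inl, Monoid.CoprodI.lift_of, dif_pos]
    rfl
  have hle : restrictedFree X l K ≤
      ((Φ.comp (restrictedFree X l K).subtype).eqLocus p).map (restrictedFree X l K).subtype := by
    refine sup_le (iSup₂_le fun μ hμ => ?_) (sup_le ?_ ?_)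
    · rintro _ ⟨h, rfl⟩
      refine ⟨⟨_, inl_of_mem_restrictedFree hμ K h⟩, ?_, rfl⟩
      change Φ (Monoid.Coprod.inl (Monoid.CoprodI.of h)) = _
      simp only [Φ, Monoid.Coprod.lift_apply_inl, Monoid.CoprodI.lift_of, dif_neg hμ]
      rfl
    · rintro _ ⟨h, hh, rfl⟩
      exact ⟨⟨_, inl_of_mem_restrictedFree_self hh⟩, (hΦl h).trans (hpg ⟨h, hh⟩).symm, rfl⟩
    · rintro _ ⟨x, rfl⟩
      refine ⟨⟨_, inr_mem_restrictedFree K x⟩, ?_, rfl⟩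
      change Φ (Monoid.Coprod.inr x) = _
      simp only [Φ, Monoid.Coprod.lift_apply_inr]
      rfl
  refine ⟨Φ, hΦl, fun w => ?_⟩
  obtain ⟨v, hv, hvw⟩ := hle w.2
  obtain rfl : v = w := Subtype.ext hvw
  exact hv

theorem eq_top_of_subset_restrictedFree (l : Λ) (K : Subgroup (H l)) {R : Set (RelFree H X)}
    (hker : (relEps H X).ker = Subgroup.normalClosure R)
    (hR : R ⊆ restrictedFree X l K)
    (hgen : (restrictedFree X l K).map (relEps H X) = ⊤) : K = ⊤ := by
  let E := restrictedFree X l K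
  let N : Subgroup E := Subgroup.normalClosure (E.subtype ⁻¹' R)
  let q : E →* E ⧸ N := QuotientGroup.mk' N
  let j : K →* E := ((Monoid.Coprod.inl.comp (Monoid.CoprodI.of (M := fun l => ↥(H l))
    (i := l))).comp K.subtype).codRestrict E fun k => inl_of_mem_restrictedFree_self k.2
  have hN : N ≤ ((relEps H X).comp E.subtype).ker := by
    refine Subgroup.normalClosure_le_normal fun r hr => ?_
    have : (r : RelFree H X) ∈ (relEps H X).ker := hker ▸ Subgroup.subset_normalClosure hr
    exact this
  have hinj : Function.Injective (q.comp j) := by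
    have hcomp : ∀ k, QuotientGroup.lift N _ hN (q (j k)) = ((k : H l) : G) := by
      intro k
      change relEps H X (Monoid.Coprod.inl (Monoid.CoprodI.of (k : H l))) = _
      simp [relEps]
    intro k k' h
    refine Subtype.ext (Subtype.ext ?_)
    rw [← hcomp, ← hcomp]
    exact congrArg _ h
  obtain ⟨P, _, f, g, hfg, hint⟩ := exists_amalgam (q.comp j) K.subtype hinj
    K.subtype_injective
  obtain ⟨Φ, hΦg, hΦf⟩ := exists_extension l K (f.comp q) g hfg
  have hΦker : (relEps H X).ker ≤ Φ.ker := by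
    rw [hker]
    refine Subgroup.normalClosure_le_normal fun r hr => ?_
    have hq : q ⟨r, hR hr⟩ = 1 :=
      (QuotientGroup.eq_one_iff _).2 (Subgroup.subset_normalClosure hr)
    exact (hΦf ⟨r, hR hr⟩).trans (by simp [hq])
  refine eq_top_iff.2 fun h _ => ?_
  obtain ⟨w, hw, hwh⟩ : (h : G) ∈ (restrictedFree X l K).map (relEps H X) :=
    hgen ▸ Subgroup.mem_top _
  have heq : relEps H X w = relEps H X (Monoid.Coprod.inl (Monoid.CoprodI.of h)) := by
    rw [hwh]
    simp [relEps]
  have hΦeq : Φ w = g h := by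
    rw [← hΦg, ← div_eq_one, ← map_div]
    exact hΦker (by rw [MonoidHom.mem_ker, map_div, heq, div_self'])
  obtain ⟨k, rfl⟩ := hint (q ⟨w, hw⟩) h ((hΦf ⟨w, hw⟩).symm.trans hΦeq)
  exact k.2

end RelHyp

/-- Proposition 2.29 / Theorem 1.1(2). If `G` is generated by a finite set `X`
in the ordinary sense and is finitely presented relative to a collection of subgroups
`{H_λ}_{λ ∈ Λ}`, then each subgroup `H_λ` is finitely generated. -/
theorem statement_0 {G : Type*} [Group G] {Λ : Type*} (H : Λ → Subgroup G)
    (X : Set G) (hXfin : X.Finite) (hXgen : Subgroup.closure X = ⊤)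
    (hfp : FinitelyPresentedRel H) :
    ∀ l : Λ, (H l).FG := by
  intro l
  obtain ⟨Y, R, hY⟩ := hfp
  obtain ⟨s, hs⟩ := hY.surj.hasRightInverse
  obtain ⟨K, hK, hsub⟩ := exists_fg_subset_restrictedFree l (hY.finR.union (hXfin.image s))
  have hgen : (restrictedFree Y l K).map (relEps H Y) = ⊤ := by
    rw [eq_top_iff, ← hXgen, Subgroup.closure_le]
    exact fun x hx => ⟨s x, hsub (Or.inr ⟨x, hx, rfl⟩), hs x⟩
  have htop := eq_top_of_subset_restrictedFree l K hY.ker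
    (Set.subset_union_left.trans hsub) hgen
  rw [← Group.fg_iff_subgroup_fg, Group.fg_def, ← htop]
  exact hK
end

section
/- Let G be a finitely generated group and {H_λ}_{λ∈Λ} a collection of nontrivial subgroups of G. If G is finitely presented relative to {H_λ}_{λ∈Λ}, then the collection of subgroups is finite, i.e. card Λ < ∞. -/
open RelHyp

/-- The homomorphism from the free product to the direct product of the `H_λ` that kills `X`
and is the canonical inclusion on each free factor `H_λ`. -/
noncomputable def RelHyp.relToPi {G : Type*} [Group G] {Λ : Type*} (H : Λ → Subgroup G)
    (X : Set G) : RelFree H X →* ∀ l : Λ, ↥(H l) :=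
  open Classical in
  Monoid.Coprod.lift
    (Monoid.CoprodI.lift fun l => MonoidHom.mulSingle (fun l => ↥(H l)) l) 1

theorem RelHyp.relToPi_inl_of_self {G : Type*} [Group G] {Λ : Type*} (H : Λ → Subgroup G)
    (X : Set G) (l : Λ) (h : ↥(H l)) :
    relToPi H X (Monoid.Coprod.inl (Monoid.CoprodI.of h)) l = h := by
  classical
  simp [relToPi]

theorem RelHyp.finite_support_relToPi {G : Type*} [Group G] {Λ : Type*} (H : Λ → Subgroup G)
    (X : Set G) (f : RelFree H X) : {l | relToPi H X f l ≠ 1}.Finite := by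
  classical
  have hmul : ∀ a b : RelFree H X, {l | relToPi H X a l ≠ 1}.Finite →
      {l | relToPi H X b l ≠ 1}.Finite → {l | relToPi H X (a * b) l ≠ 1}.Finite := by
    intro a b ha hb
    refine (ha.union hb).subset fun l hl => ?_
    by_contra hc
    simp only [Set.mem_union, Set.mem_ofPred_eq, not_or, not_not] at hc
    exact hl (by rw [map_mul, Pi.mul_apply, hc.1, hc.2, one_mul])
  induction f using Monoid.Coprod.induction_on with
  | inl a =>
    induction a using Monoid.CoprodI.induction_on with
    | one => simp
    | of m h =>
      refine (Set.finite_singleton m).subset fun l hl => ?_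
      by_contra hne
      exact hl (by simp [relToPi, Pi.mulSingle_eq_of_ne hne])
    | mul a b ha hb => simpa only [map_mul] using hmul _ _ ha hb
  | inr x => simp [relToPi]
  | mul a b ha hb => exact hmul a b ha hb

/-- Corollary 2.48 / Theorem 1.1(1). If a finitely generated group `G` is
finitely presented relative to a collection of nontrivial subgroups `{H_λ}_{λ ∈ Λ}`, then the
collection is finite, i.e. `card Λ < ∞`. -/
theorem statement_1 {G : Type*} [Group G] {Λ : Type*} (H : Λ → Subgroup G)
    (X : Set G) (hXfin : X.Finite) (hXgen : Subgroup.closure X = ⊤)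
    (hnt : ∀ l : Λ, H l ≠ ⊥) (hfp : FinitelyPresentedRel H) :
    Finite Λ := by
  obtain ⟨Y, R, hP⟩ := hfp
  choose σ hσ using hP.surj
  let S : Set Λ := ⋃ f ∈ R ∪ σ '' X, {l | relToPi H Y f l ≠ 1}
  have hS : S.Finite :=
    (hP.finR.union (hXfin.image σ)).biUnion fun f _ => finite_support_relToPi H Y f
  refine Set.finite_univ_iff.mp (hS.subset fun l _ => ?_)
  by_contra hl
  have hkill : ∀ f ∈ R ∪ σ '' X, relToPi H Y f l = 1 := by
    intro f hf
    by_contra hne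
    exact hl (Set.mem_biUnion hf hne)
  let φ : RelFree H Y →* ↥(H l) := (Pi.evalMonoidHom _ l).comp (relToPi H Y)
  have hker : (relEps H Y).ker ≤ φ.ker := by
    rw [hP.ker]
    exact Subgroup.normalClosure_le_normal fun r hr => hkill r (Or.inl hr)
  have hmap : φ.ker.map (relEps H Y) = ⊤ := by
    rw [eq_top_iff, ← hXgen, Subgroup.closure_le]
    exact fun x hx => ⟨σ x, hkill _ (Or.inr ⟨x, hx, rfl⟩), hσ x⟩
  have htop : φ.ker = ⊤ := by
    rw [← Subgroup.comap_map_eq_self hker, hmap, Subgroup.comap_top]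
  refine hnt l ((Subgroup.eq_bot_iff_forall _).mpr fun h hh => ?_)
  have hone : φ (Monoid.Coprod.inl (Monoid.CoprodI.of (⟨h, hh⟩ : ↥(H l)))) = 1 :=
    φ.mem_ker.mp (htop ▸ Subgroup.mem_top _)
  exact congrArg Subtype.val ((relToPi_inl_of_self H Y l ⟨h, hh⟩).symm.trans hone)
end

section
/- Let G be a group and {H_λ}_{λ∈Λ} a collection of subgroups of G. Suppose that G is finitely presented relative to {H_λ}_{λ∈Λ} and that the relative Dehn function of G with respect to {H_λ}_{λ∈Λ} is well-defined. Then: (1) for any λ ≠ μ and any g₁, g₂ ∈ G, the intersection H_λ^{g₁} ∩ H_μ^{g₂} is finite; (2) for any λ and any g ∉ H_λ, the intersection H_λ^{g} ∩ H_λ is finite. (Here H^g denotes g⁻¹Hg.) -/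
namespace RelHyp

variable {G : Type*} [Group G] {Λ : Type*} {H : Λ → Subgroup G} {X : Set G}

/-- The embedding of `H_l` into the free product `F`. -/
def peripheral (H : Λ → Subgroup G) (X : Set G) (l : Λ) : ↥(H l) →* RelFree H X :=
  Monoid.Coprod.inl.comp (Monoid.CoprodI.of (M := fun m => ↥(H m)))

/-- `D` is a derivation from `F` to the left `G`-module of functions `G → ℤ` that is trivial on
all the free factors of `F` except `H_l`, where it is the inner derivation given by `φ`. -/
structure IsPeripheralDerivation (l : Λ) (φ : G → ℤ) (D : RelFree H X → G → ℤ) : Prop where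
  map_mul : ∀ u v x, D (u * v) x = D u x + D v ((relEps H X u)⁻¹ * x)
  peripheral_self : ∀ (h : ↥(H l)) x, D (peripheral H X l h) x = φ x - φ ((h : G)⁻¹ * x)
  peripheral_of_ne : ∀ (m : Λ) (h : ↥(H m)) x, m ≠ l → D (peripheral H X m h) x = 0
  inr : ∀ y x, D (Monoid.Coprod.inr y) x = 0

@[simp]
lemma relEps_peripheral (l : Λ) (h : ↥(H l)) : relEps H X (peripheral H X l h) = h := by
  simp [relEps, peripheral]

open scoped Classical in
lemma exists_isPeripheralDerivation (H : Λ → Subgroup G) (X : Set G) (l : Λ) (φ : G → ℤ) :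
    ∃ D : RelFree H X → G → ℤ, IsPeripheralDerivation l φ D := by
  let s : (G → Multiplicative ℤ) ⋊[mulAutArrow] G :=
    SemidirectProduct.inl fun x => Multiplicative.ofAdd (φ x)
  let j : G →* (G → Multiplicative ℤ) ⋊[mulAutArrow] G := SemidirectProduct.inr
  let θ : RelFree H X →* (G → Multiplicative ℤ) ⋊[mulAutArrow] G := Monoid.Coprod.lift
    (Monoid.CoprodI.lift fun m =>
      if m = l then (MulAut.conj s).toMonoidHom.comp (j.comp (H m).subtype)
      else j.comp (H m).subtype)
    (j.comp (FreeGroup.lift fun x => (x : G)))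
  have hleft : ∀ (p q : (G → Multiplicative ℤ) ⋊[mulAutArrow] G) x,
      (p * q).left x = p.left x * q.left (p.right⁻¹ * x) := fun _ _ _ => rfl
  have hright : ∀ u, (θ u).right = relEps H X u := by
    intro u
    suffices SemidirectProduct.rightHom.comp θ = relEps H X from DFunLike.congr_fun this u
    ext m h
    · by_cases hm : m = l <;> simp [θ, relEps, hm, s, j]
    · simp [θ, relEps, j]
  have hper : ∀ m (h : ↥(H m)), θ (peripheral H X m h) =
      if m = l then s * j h * s⁻¹ else j h := by
    intro m h
    by_cases hm : m = l <;> simp [θ, peripheral, hm]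
  refine ⟨fun u x => Multiplicative.toAdd ((θ u).left x), ?_, ?_, ?_, ?_⟩
  · intro u v x
    rw [map_mul, hleft, hright, toAdd_mul]
  · intro h x
    have hs : s⁻¹ = SemidirectProduct.inl fun x => (Multiplicative.ofAdd (φ x))⁻¹ :=
      (map_inv SemidirectProduct.inl _).symm
    change Multiplicative.toAdd ((θ (peripheral H X l h)).left x) = _
    rw [hper, if_pos rfl, hleft, hleft, hs]
    simp [s, j, sub_eq_add_neg]
  · intro m h x hm
    simp [hper, hm, j]
  · intro y x
    simp [θ, j]

namespace IsPeripheralDerivation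

variable {l : Λ} {φ : G → ℤ} {D : RelFree H X → G → ℤ}

lemma map_one (hD : IsPeripheralDerivation l φ D) (x : G) : D 1 x = 0 := by
  simpa using hD.map_mul 1 1 x

lemma map_inv (hD : IsPeripheralDerivation l φ D) (u : RelFree H X) (x : G) :
    D u⁻¹ x = - D u (relEps H X u * x) := by
  have h := hD.map_mul u⁻¹ u x
  simp only [inv_mul_cancel, hD.map_one, _root_.map_inv, inv_inv] at h
  omega

/-- Conjugation of an element of the kernel of `ε` only translates the derivation. -/
lemma map_conj (hD : IsPeripheralDerivation l φ D) {r : RelFree H X} (hr : relEps H X r = 1)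
    (c : RelFree H X) (x : G) : D (c⁻¹ * r * c) x = D r (relEps H X c * x) := by
  simp [hD.map_mul, hD.map_inv, hr]

/-- The derivation of a product of `k` conjugates of relators is bounded linearly in `k`. -/
lemma abs_map_prod_le (hD : IsPeripheralDerivation l φ D) {M : ℤ} (L : List (RelFree H X))
    (hL : ∀ u ∈ L, relEps H X u = 1 ∧ ∀ x, |D u x| ≤ M) (x : G) :
    |D L.prod x| ≤ L.length * M := by
  induction L with
  | nil => simp [hD.map_one]
  | cons u L ih =>
    have h₁ := hL u (by simp)
    have h₂ := ih fun v hv => hL v (by simp [hv])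
    have h₃ := h₁.2 x
    rw [List.prod_cons, hD.map_mul, h₁.1, inv_one, one_mul, List.length_cons]
    have := abs_add_le (D u x) (D L.prod x)
    push_cast
    linarith

/-- If no nonempty terminal subword of `w` represents an element of `H_l`, and `φ` vanishes
outside `H_l`, then the derivation of `w` vanishes on the coset `ε(w) H_l`. -/
lemma map_word_eq_zero (hD : IsPeripheralDerivation l φ D) (hφ : ∀ x, x ∉ H l → φ x = 0)
    (w : List (RelLetter H X))
    (hw : ∀ v, v <:+ w → v ≠ [] → relEps H X (wordToF v) ∉ H l) {h : G} (hh : h ∈ H l) :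
    D (wordToF w) (relEps H X (wordToF w) * h) = 0 := by
  induction w with
  | nil => simp [wordToF, hD.map_one]
  | cons a v ih =>
    have h₀ := hw (a :: v) List.suffix_rfl (by simp)
    have h₁ := ih fun v' hv' => hw v' (hv'.trans (List.suffix_cons a v))
    have hcons : wordToF (a :: v) = a.toF * wordToF v := by simp [wordToF]
    rw [hcons] at h₀ ⊢
    rw [hD.map_mul, _root_.map_mul]
    rw [show (relEps H X a.toF)⁻¹ * (relEps H X a.toF * relEps H X (wordToF v) * h) =
      relEps H X (wordToF v) * h by group, h₁, add_zero]
    rcases a with ⟨m, k, hk⟩ | ⟨y, b⟩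
    · change D (peripheral H X m k) _ = 0
      change relEps H X (peripheral H X m k * _) ∉ H l at h₀
      by_cases hm : m = l
      · subst hm
        rw [_root_.map_mul, relEps_peripheral] at h₀
        change D (peripheral H X m k) (relEps H X (peripheral H X m k) * _ * h) = 0
        have h₂ : relEps H X (wordToF v) ∉ H m := fun h' => h₀ ((H m).mul_mem k.2 h')
        rw [hD.peripheral_self, relEps_peripheral, hφ, hφ, sub_zero]
        · rwa [mul_assoc (k : G), inv_mul_cancel_left, (H m).mul_mem_cancel_right hh]
        · rwa [(H m).mul_mem_cancel_right hh]
      · exact hD.peripheral_of_ne m k _ hm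
    · exact hD.inr _ _

end IsPeripheralDerivation

/-- The derivation of a fixed element `u` of `F` is bounded in terms of the oscillation of `φ`
along finitely many elements of `H_l`. -/
lemma exists_finite_bound (l : Λ) (u : RelFree H X) :
    ∃ Ω : Set G, Ω.Finite ∧ Ω ⊆ H l ∧ ∃ M : ℕ, ∀ φ D, IsPeripheralDerivation (X := X) l φ D →
      (∀ ω ∈ Ω, ∀ x, |φ x - φ (ω⁻¹ * x)| ≤ 1) → ∀ x, |D u x| ≤ M := by
  have mul : ∀ u v : RelFree H X,
      (∃ Ω : Set G, Ω.Finite ∧ Ω ⊆ H l ∧ ∃ M : ℕ, ∀ φ D, IsPeripheralDerivation (X := X) l φ D →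
        (∀ ω ∈ Ω, ∀ x, |φ x - φ (ω⁻¹ * x)| ≤ 1) → ∀ x, |D u x| ≤ M) →
      (∃ Ω : Set G, Ω.Finite ∧ Ω ⊆ H l ∧ ∃ M : ℕ, ∀ φ D, IsPeripheralDerivation (X := X) l φ D →
        (∀ ω ∈ Ω, ∀ x, |φ x - φ (ω⁻¹ * x)| ≤ 1) → ∀ x, |D v x| ≤ M) →
      (∃ Ω : Set G, Ω.Finite ∧ Ω ⊆ H l ∧ ∃ M : ℕ, ∀ φ D, IsPeripheralDerivation (X := X) l φ D →
        (∀ ω ∈ Ω, ∀ x, |φ x - φ (ω⁻¹ * x)| ≤ 1) → ∀ x, |D (u * v) x| ≤ M) := by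
    rintro u v ⟨Ω, hΩ, hΩl, M, hM⟩ ⟨Ω', hΩ', hΩl', M', hM'⟩
    refine ⟨Ω ∪ Ω', hΩ.union hΩ', Set.union_subset hΩl hΩl', M + M', fun φ D hD hφ x => ?_⟩
    rw [hD.map_mul]
    have h₁ := hM φ D hD (fun ω hω => hφ ω (Or.inl hω)) x
    have h₂ := hM' φ D hD (fun ω hω => hφ ω (Or.inr hω)) ((relEps H X u)⁻¹ * x)
    have := abs_add_le (D u x) (D v ((relEps H X u)⁻¹ * x))
    push_cast
    linarith
  induction u using Monoid.Coprod.induction_on with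
  | mul u v hu hv => exact mul u v hu hv
  | inr y => exact ⟨∅, Set.finite_empty, by simp, 0, fun φ D hD _ x => by simp [hD.inr]⟩
  | inl y =>
    induction y using Monoid.CoprodI.induction_on with
    | one =>
      refine ⟨∅, Set.finite_empty, by simp, 0, fun φ D hD _ x => ?_⟩
      simp [hD.map_one]
    | mul y z hy hz =>
      rw [map_mul]
      exact mul _ _ hy hz
    | of m h =>
      by_cases hm : m = l
      · subst hm
        refine ⟨{(h : G)}, Set.finite_singleton _, by simp, 1, fun φ D hD hφ x => ?_⟩
        change |D (peripheral H X m h) x| ≤ _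
        rw [hD.peripheral_self]
        exact_mod_cast hφ h rfl x
      · refine ⟨∅, Set.finite_empty, by simp, 0, fun φ D hD _ x => ?_⟩
        change |D (peripheral H X m h) x| ≤ _
        simp [hD.peripheral_of_ne m h x hm]

/-- A uniform version of `exists_finite_bound` for a finite set of relators. -/
lemma exists_finite_bound_of_finite (l : Λ) {R : Set (RelFree H X)} (hR : R.Finite) :
    ∃ Ω : Set G, Ω.Finite ∧ Ω ⊆ H l ∧ ∃ M : ℕ, ∀ φ D, IsPeripheralDerivation (X := X) l φ D →
      (∀ ω ∈ Ω, ∀ x, |φ x - φ (ω⁻¹ * x)| ≤ 1) → ∀ r ∈ R, ∀ x, |D r x| ≤ M := by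
  choose Ω hΩ hΩl M hM using exists_finite_bound (H := H) (X := X) l
  refine ⟨⋃ r ∈ R, Ω r, hR.biUnion fun r _ => hΩ r, by simpa using fun r _ => hΩl r,
    ∑ r ∈ hR.toFinset, M r, fun φ D hD hφ r hr x => ?_⟩
  refine (hM r φ D hD (fun ω hω => hφ ω (Set.mem_biUnion hr hω)) x).trans ?_
  exact_mod_cast Finset.single_le_sum (f := M) (fun _ _ => Nat.zero_le _) (by simpa using hr)

open scoped Pointwise in
/-- A function on `G`, supported on a finite subset of `K`, which equals `T` at the identity and
varies by at most `1` along left multiplication by elements of the finite set `Ω ⊆ K`. -/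
lemma exists_slowly_varying {K : Subgroup G} {Ω : Set G} (hΩ : Ω.Finite) (hΩK : Ω ⊆ K) (T : ℕ) :
    ∃ φ : G → ℤ, φ 1 = T ∧ (∀ ω ∈ Ω, ∀ x, |φ x - φ (ω⁻¹ * x)| ≤ 1) ∧
      (∀ x, x ∉ K → φ x = 0) ∧ {x | φ x ≠ 0}.Finite := by
  classical
  set S : Set G := insert 1 (Ω ∪ Ω⁻¹) with hS
  have hSfin : S.Finite := (hΩ.union hΩ.inv).insert 1
  have hSK : S ⊆ K := by
    rintro x (rfl | hx | hx)
    · exact K.one_mem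
    · exact hΩK hx
    · exact K.inv_mem_iff.1 (hΩK hx)
  have hpowK : ∀ n, S ^ n ⊆ K := by
    intro n
    induction n with
    | zero => simp [K.one_mem]
    | succ n ih =>
      rw [pow_succ]
      rintro _ ⟨a, ha, b, hb, rfl⟩
      exact K.mul_mem (ih ha) (hSK hb)
  have hpowfin : ∀ n, (S ^ n).Finite := by
    intro n
    induction n with
    | zero => simp
    | succ n ih => rw [pow_succ]; exact ih.mul hSfin
  let φ : G → ℤ := fun x => ∑ n ∈ Finset.range T, if x ∈ S ^ n then 1 else 0
  have step : ∀ s ∈ S, ∀ x, φ x ≤ φ (s * x) + 1 := by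
    intro s hs x
    cases T with
    | zero => simp [φ]
    | succ T =>
      simp only [φ]
      rw [Finset.sum_range_succ, Finset.sum_range_succ']
      have h₁ : ∑ n ∈ Finset.range T, (if x ∈ S ^ n then (1 : ℤ) else 0) ≤
          ∑ n ∈ Finset.range T, if s * x ∈ S ^ (n + 1) then (1 : ℤ) else 0 := by
        refine Finset.sum_le_sum fun n _ => ?_
        by_cases hx : x ∈ S ^ n
        · have : s * x ∈ S ^ (n + 1) := by
            rw [pow_succ']
            exact Set.mul_mem_mul hs hx
          simp [hx, this]
        · rw [if_neg hx]
          split_ifs <;> simp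
      have h₂ : (if x ∈ S ^ T then (1 : ℤ) else 0) ≤ 1 := by split_ifs <;> simp
      have h₃ : 0 ≤ (if s * x ∈ S ^ 0 then (1 : ℤ) else 0) := by split_ifs <;> simp
      linarith
  have hzero : ∀ x, φ x ≠ 0 → ∃ n < T, x ∈ S ^ n := by
    intro x hx
    by_contra! hcon
    exact hx (Finset.sum_eq_zero fun n hn => if_neg (hcon n (Finset.mem_range.1 hn)))
  refine ⟨φ, ?_, ?_, ?_, ?_⟩
  · have : ∀ n, (1 : G) ∈ S ^ n := fun n => Set.one_mem_pow (Set.mem_insert _ _)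
    simp [φ, this]
  · intro ω hω x
    have h₁ := step ω⁻¹ (Or.inr (Or.inr (by simpa using hω))) x
    have h₂ := step ω (Or.inr (Or.inl hω)) (ω⁻¹ * x)
    rw [mul_inv_cancel_left] at h₂
    rw [abs_le]
    constructor <;> linarith
  · intro x hx
    by_contra hne
    obtain ⟨n, -, hn⟩ := hzero x hne
    exact hx (hpowK n hn)
  · refine ((Set.finite_lt_nat T).biUnion fun n _ => hpowfin n).subset fun x hx => ?_
    obtain ⟨n, hn, hxn⟩ := hzero x hx
    exact Set.mem_biUnion (show n ∈ {i | i < T} from hn) hxn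

lemma wordToF_append (v w : List (RelLetter H X)) :
    wordToF (v ++ w) = wordToF v * wordToF w := by
  simp [wordToF]

lemma exists_wordToF_peripheral (l : Λ) (h : ↥(H l)) :
    ∃ w : List (RelLetter H X), w.length ≤ 1 ∧ wordToF w = peripheral H X l h := by
  by_cases hh : h = 1
  · exact ⟨[], by simp, by simp [wordToF, hh]⟩
  · exact ⟨[Sum.inl ⟨l, h, hh⟩], by simp, by simp [wordToF, RelLetter.toF, peripheral]⟩

lemma wordToF_surjective : Function.Surjective (wordToF (H := H) (X := X)) := by
  have mul : ∀ u v : RelFree H X, (∃ w, wordToF w = u) → (∃ w, wordToF w = v) →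
      ∃ w, wordToF w = u * v := by
    rintro _ _ ⟨u, rfl⟩ ⟨v, rfl⟩
    exact ⟨u ++ v, wordToF_append u v⟩
  intro u
  induction u using Monoid.Coprod.induction_on with
  | mul u v hu hv => exact mul u v hu hv
  | inl y =>
    induction y using Monoid.CoprodI.induction_on with
    | one => exact ⟨[], by simp [wordToF]⟩
    | mul y z hy hz => rw [map_mul]; exact mul _ _ hy hz
    | of m h =>
      obtain ⟨w, -, hw⟩ := exists_wordToF_peripheral (X := X) m h
      exact ⟨w, hw⟩
  | inr y =>
    induction y using FreeGroup.induction_on with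
    | C1 => exact ⟨[], by simp [wordToF]⟩
    | of x => exact ⟨[Sum.inr (x, true)], by simp [wordToF, RelLetter.toF]⟩
    | inv_of x _ => exact ⟨[Sum.inr (x, false)], by simp [wordToF, RelLetter.toF]⟩
    | mul y z hy hz => rw [map_mul]; exact mul _ _ hy hz

/-- Every left coset of `H_l` contains an element represented by a word none of whose nonempty
terminal subwords represents an element of `H_l`. -/
lemma exists_word_mem_coset (hsurj : Function.Surjective (relEps H X)) (l : Λ) (g : G) :
    ∃ w : List (RelLetter H X), g⁻¹ * relEps H X (wordToF w) ∈ H l ∧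
      ∀ v, v <:+ w → v ≠ [] → relEps H X (wordToF v) ∉ H l := by
  let P : Set (List (RelLetter H X)) := {w | g⁻¹ * relEps H X (wordToF w) ∈ H l}
  have hP : P.Nonempty := by
    obtain ⟨u, hu⟩ := hsurj g
    obtain ⟨w, rfl⟩ := wordToF_surjective u
    exact ⟨w, by simp [P, hu, (H l).one_mem]⟩
  obtain ⟨w, hw, hmin⟩ := (measure (List.length (α := RelLetter H X))).wf.has_min P hP
  refine ⟨w, hw, ?_⟩
  rintro v ⟨u, rfl⟩ hv hvl
  refine hmin u ?_ ?_
  · have hw' : g⁻¹ * relEps H X (wordToF (u ++ v)) ∈ H l := hw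
    rwa [wordToF_append, map_mul, ← mul_assoc, (H l).mul_mem_cancel_right hvl] at hw'
  · change u.length < (u ++ v).length
    have := List.length_pos_iff.2 hv
    rw [List.length_append]
    omega

variable {R : Set (RelFree H X)}

/-- Finiteness of the intersection `H_l ∩ H_μ^g` when `g` is represented by a word without
nonempty terminal subwords in `H_l`. -/
lemma finite_inter_conj_of_word (hpres : IsFiniteRelPres H X R) (hwd : DehnWellDefined H X R)
    {l μ : Λ} (w : List (RelLetter H X))
    (hw : ∀ v, v <:+ w → v ≠ [] → relEps H X (wordToF v) ∉ H l)
    (hg : l = μ → relEps H X (wordToF w) ∉ H l) :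
    {a : G | a ∈ H l ∧ relEps H X (wordToF w) * a * (relEps H X (wordToF w))⁻¹ ∈ H μ}.Finite := by
  obtain ⟨f, hf⟩ := hwd
  obtain ⟨Ω, hΩ, hΩl, M, hM⟩ := exists_finite_bound_of_finite l hpres.finR
  obtain ⟨w', hw'⟩ := wordToF_surjective (wordToF w)⁻¹
  set g := relEps H X (wordToF w) with hgdef
  let n := w.length + w'.length + 2
  let N := ∑ i ∈ Finset.range (n + 1), f i
  obtain ⟨φ, hφ1, hφΩ, hφl, hφfin⟩ := exists_slowly_varying hΩ hΩl (N * M + 1)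
  obtain ⟨D, hD⟩ := exists_isPeripheralDerivation H X l φ
  refine (hφfin.preimage (inv_injective.injOn)).subset ?_
  rintro a ⟨ha, hb⟩
  change φ a⁻¹ ≠ 0
  intro hzero
  obtain ⟨wa, hwa, hwa'⟩ := exists_wordToF_peripheral (X := X) l ⟨a, ha⟩
  obtain ⟨wb, hwb, hwb'⟩ := exists_wordToF_peripheral (X := X) μ (⟨g * a * g⁻¹, hb⟩⁻¹)
  set W := w ++ (wa ++ (w' ++ wb)) with hW
  have hWF : wordToF W = wordToF w * (peripheral H X l ⟨a, ha⟩ * ((wordToF w)⁻¹ *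
      peripheral H X μ (⟨g * a * g⁻¹, hb⟩⁻¹))) := by
    simp only [hW, wordToF_append, hwa', hwb', hw']
  have hW1 : relEps H X (wordToF W) = 1 := by
    rw [hWF]
    simp only [map_mul, map_inv, relEps_peripheral, ← hgdef]
    group
  have hWlen : W.length < n + 1 := by
    simp only [hW, n, List.length_append]
    omega
  obtain ⟨k, hk, r, c, hr, hprod⟩ := hf W hW1
  have hupper : |D (wordToF W) g| ≤ N * M := by
    have hker : ∀ i, relEps H X (r i) = 1 := fun i => by
      rw [← MonoidHom.mem_ker, hpres.ker]
      exact Subgroup.subset_normalClosure (hr i)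
    have h₁ := hD.abs_map_prod_le (M := M) (List.ofFn fun i => (c i)⁻¹ * r i * c i) (by
      intro u hu
      obtain ⟨i, rfl⟩ := (List.mem_ofFn' _ _).1 hu
      refine ⟨by simp [hker], fun x => ?_⟩
      rw [hD.map_conj (hker i)]
      exact hM φ D hD hφΩ _ (hr i) _) g
    rw [← hprod, List.length_ofFn] at h₁
    have h₂ : k ≤ N := hk.trans
      (Finset.single_le_sum (f := f) (fun _ _ => Nat.zero_le _) (Finset.mem_range.2 hWlen))
    refine h₁.trans ?_
    gcongr
  have hlower : D (wordToF W) g = N * M + 1 := by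
    have h₁ : D (wordToF w) g = 0 := by
      simpa using hD.map_word_eq_zero hφl w hw (H l).one_mem
    have h₂ : D (wordToF w) (g * a⁻¹) = 0 :=
      hD.map_word_eq_zero hφl w hw ((H l).inv_mem ha)
    have h₃ : D (peripheral H X μ (⟨g * a * g⁻¹, hb⟩⁻¹)) (g * a⁻¹) = 0 := by
      by_cases hlμ : μ = l
      · subst hlμ
        have hg' := hg rfl
        rw [hD.peripheral_self, hφl, hφl, sub_zero]
        · rwa [InvMemClass.coe_inv, inv_inv, (H μ).mul_mem_cancel_left hb,
            (H μ).mul_mem_cancel_right ((H μ).inv_mem ha)]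
        · rwa [(H μ).mul_mem_cancel_right ((H μ).inv_mem ha)]
      · exact hD.peripheral_of_ne μ _ _ hlμ
    rw [hWF, hD.map_mul, h₁, hD.map_mul, hD.map_mul, hD.peripheral_self, hD.map_inv,
      relEps_peripheral, map_inv (relEps H X) (wordToF w), ← hgdef, inv_inv, inv_mul_cancel,
      mul_one]
    dsimp only
    rw [h₂, h₃, hφ1, hzero]
    push_cast
    ring
  rw [hlower, abs_of_nonneg (by positivity)] at hupper
  omega

/-- `H_l ∩ H_μ^g` is finite if `l ≠ μ` or `g ∉ H_l`. -/
lemma finite_inter_conj (hpres : IsFiniteRelPres H X R) (hwd : DehnWellDefined H X R)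
    {l μ : Λ} {g : G} (hg : l = μ → g ∉ H l) :
    {a : G | a ∈ H l ∧ g * a * g⁻¹ ∈ H μ}.Finite := by
  obtain ⟨w, hwg, hw⟩ := exists_word_mem_coset hpres.surj l g
  set h := g⁻¹ * relEps H X (wordToF w) with hdef
  have hgh : relEps H X (wordToF w) = g * h := by rw [hdef, mul_inv_cancel_left]
  have hfin := finite_inter_conj_of_word hpres hwd (μ := μ) w hw fun e => by
    rw [hgh, (H l).mul_mem_cancel_right hwg]
    exact hg e
  refine (hfin.preimage (f := fun a => h⁻¹ * a * h) fun a _ b _ hab => by simpa using hab).subset ?_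
  rintro a ⟨ha, hb⟩
  refine ⟨(H l).mul_mem ((H l).mul_mem ((H l).inv_mem hwg) ha) hwg, ?_⟩
  rw [hgh]
  convert hb using 1
  group

end RelHyp

open RelHyp

/-- Theorem 1.5 / Proposition 2.36. Suppose `G` is finitely presented relative
to `{H_λ}` and the relative Dehn function is well-defined. Then (1) `H_λ^{g₁} ∩ H_μ^{g₂}` is
finite whenever `λ ≠ μ`, and (2) `H_λ^g ∩ H_λ` is finite for `g ∉ H_λ`
(here `x ∈ H^g ↔ g x g⁻¹ ∈ H`). -/
theorem statement_2 {G : Type*} [Group G] {Λ : Type*} (H : Λ → Subgroup G)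
    (X : Set G) (R : Set (RelFree H X))
    (hpres : IsFiniteRelPres H X R) (hwd : DehnWellDefined H X R) :
    (∀ l μ : Λ, l ≠ μ → ∀ g₁ g₂ : G,
        {x : G | g₁ * x * g₁⁻¹ ∈ H l ∧ g₂ * x * g₂⁻¹ ∈ H μ}.Finite) ∧
    (∀ (l : Λ) (g : G), g ∉ H l →
        {x : G | g * x * g⁻¹ ∈ H l ∧ x ∈ H l}.Finite) := by
  refine ⟨fun l μ hlμ g₁ g₂ => ?_, fun l g hg => ?_⟩
  · have hfin := finite_inter_conj hpres hwd (g := g₂ * g₁⁻¹) fun e : l = μ => absurd e hlμ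
    refine (hfin.preimage (f := fun x => g₁ * x * g₁⁻¹) fun a _ b _ hab => by
      simpa using hab).subset ?_
    rintro x ⟨h₁, h₂⟩
    refine ⟨h₁, ?_⟩
    convert h₂ using 1
    group
  · simpa only [and_comm] using finite_inter_conj hpres hwd (μ := l) fun _ => hg
end
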